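/- For every f, ξ ∈ C_c(Γ⋉X) and every integer k ≥ 1, one has ‖Δ^k(f)(ξ)‖ ≤ ‖M_ℓ^k(f)‖_I · ‖ξ‖. -/

import Mathlib

open scoped ENNReal

noncomputable section

variable {Γ X : Type*} [Group Γ] [TopologicalSpace X] [MulAction Γ X]

/-- `f ∈ C_c(Γ ⋉ X)` : each `f g : X → ℂ` is continuous, and `f g ≡ 0` for all but
finitely many `g ∈ Γ`. -/
def IsCc (f : Γ → X → ℂ) : Prop :=
  (∀ g : Γ, Continuous (f g)) ∧ {g : Γ | f g ≠ 0}.Finite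

/-- Convolution: `(f ∗ ξ)(g, x) = Σ_{h ∈ Γ} f (g h⁻¹, h ⋅ x) ξ (h, x)`. -/
def convCc (f ξ : Γ → X → ℂ) : Γ → X → ℂ :=
  fun g x => ∑ᶠ h : Γ, f (g * h⁻¹) (h • x) * ξ h x

/-- Involution: `f^*(g, x) = conj (f (g⁻¹, g ⋅ x))`. -/
def starCc (f : Γ → X → ℂ) : Γ → X → ℂ :=
  fun g x => (starRingEnd ℂ) (f g⁻¹ (g • x))

/-- Pointwise multiplication by the length function: `M_ℓ(f)(g,x) = ℓ(g,x) f(g,x)`. -/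
def mulLen (ℓ : Γ → X → ℝ) (f : Γ → X → ℂ) : Γ → X → ℂ :=
  fun g x => (ℓ g x : ℂ) * f g x

/-- Iterated derivation: `Δ⁰(f)(ξ) = f ∗ ξ` and
`Δ^k(f)(ξ) = M_ℓ(Δ^{k-1}(f)(ξ)) − Δ^{k-1}(f)(M_ℓ(ξ))`. -/
def deltaIter (ℓ : Γ → X → ℝ) (f : Γ → X → ℂ) : ℕ → (Γ → X → ℂ) → Γ → X → ℂ
  | 0, ξ => convCc f ξ
  | k + 1, ξ => mulLen ℓ (deltaIter ℓ f k ξ) - deltaIter ℓ f k (mulLen ℓ ξ)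

/-- Hilbert-module norm: `‖ξ‖ = sup_{x ∈ X} (Σ_{g ∈ Γ} |ξ(g,x)|²)^{1/2}`. -/
def hnorm (ξ : Γ → X → ℂ) : ℝ :=
  ⨆ x : X, Real.sqrt (∑ᶠ g : Γ, ‖ξ g x‖ ^ 2)

/-- The I-norm `‖f‖_I`. -/
def normI (f : Γ → X → ℂ) : ℝ :=
  max (⨆ x : X, ∑ᶠ g : Γ, ‖f g x‖) (⨆ x : X, ∑ᶠ g : Γ, ‖f g⁻¹ (g • x)‖)

/-- The `C(X)`-valued inner product: `⟨⟨ξ, η⟩⟩(x) = Σ_{g ∈ Γ} conj(ξ(g,x)) η(g,x)`. -/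
def innerCc (ξ η : Γ → X → ℂ) (x : X) : ℂ :=
  ∑ᶠ g : Γ, (starRingEnd ℂ) (ξ g x) * η g x

/-- Reduced norm: `‖f‖_red = sup { ‖f ∗ ξ‖ : ξ ∈ C_c, ‖ξ‖ ≤ 1 }`. -/
def redNorm (f : Γ → X → ℂ) : ℝ :=
  sSup {r : ℝ | ∃ ξ : Γ → X → ℂ, IsCc ξ ∧ hnorm ξ ≤ 1 ∧ r = hnorm (convCc f ξ)}

/-- The quasi-seminorm `L_ℓ^k(f) = sup { ‖Δ^k(f)(ξ)‖ : ξ ∈ C_c, ‖ξ‖ ≤ 1 }`. -/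
def lipK (ℓ : Γ → X → ℝ) (k : ℕ) (f : Γ → X → ℂ) : ℝ :=
  sSup {r : ℝ | ∃ ξ : Γ → X → ℂ, IsCc ξ ∧ hnorm ξ ≤ 1 ∧ r = hnorm (deltaIter ℓ f k ξ)}

/-- `‖f‖_{2,p,s,ℓ}`. -/
def norm2s (ℓ : Γ → X → ℝ) (p : ℝ) (f : Γ → X → ℂ) : ℝ :=
  ⨆ x : X, Real.sqrt (∑ᶠ g : Γ, ‖f g x‖ ^ 2 * (1 + ℓ g x) ^ (2 * p))

/-- `‖f‖_{2,p,r,ℓ}`. -/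
def norm2r (ℓ : Γ → X → ℝ) (p : ℝ) (f : Γ → X → ℂ) : ℝ :=
  ⨆ x : X, Real.sqrt (∑ᶠ g : Γ, ‖f g⁻¹ (g • x)‖ ^ 2 * (1 + ℓ g x) ^ (2 * p))

/-- `‖f‖_{2,p,ℓ} = max (‖f‖_{2,p,s,ℓ}, ‖f‖_{2,p,r,ℓ})`. -/
def norm2 (ℓ : Γ → X → ℝ) (p : ℝ) (f : Γ → X → ℂ) : ℝ :=
  max (norm2s ℓ p f) (norm2r ℓ p f)

/-- A length function on the transformation groupoid `Γ ⋉ X`. -/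
def IsLength (ℓ : Γ → X → ℝ) : Prop :=
  (∀ g : Γ, Continuous (ℓ g)) ∧ (∀ (g : Γ) (x : X), 0 ≤ ℓ g x) ∧
    (∀ (g : Γ) (x : X), ℓ g x = 0 ↔ g = 1) ∧
    (∀ (g : Γ) (x : X), ℓ g⁻¹ (g • x) = ℓ g x) ∧
    (∀ (g h : Γ) (x : X), ℓ (g * h) x ≤ ℓ g (h • x) + ℓ h x)

/-- Properness: for every `R ≥ 0`, only finitely many non-identity `g` satisfy
`ℓ(g, x) ≤ R` for some `x`. -/
def IsProperLen (ℓ : Γ → X → ℝ) : Prop :=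
  ∀ R : ℝ, {g : Γ | g ≠ 1 ∧ ∃ x : X, ℓ g x ≤ R}.Finite

theorem finsum_le_of_forall_sum_le {α : Type*} {u : α → ℝ} {B : ℝ}
    (h : ∀ s : Finset α, ∑ a ∈ s, u a ≤ B) : ∑ᶠ a, u a ≤ B := by
  classical
  rw [finsum_def]
  split_ifs with hs
  · exact h _
  · simpa using h ∅

theorem sum_le_finsum_of_nonneg {α : Type*} {u : α → ℝ} (hu : ∀ a, 0 ≤ u a)
    (hfin : (Function.support u).Finite) (s : Finset α) : ∑ a ∈ s, u a ≤ ∑ᶠ a, u a := by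
  classical
  rw [finsum_eq_sum_of_support_subset (s := s ∪ hfin.toFinset) u
    (fun a ha => by simpa using Or.inr ha)]
  exact Finset.sum_le_sum_of_subset_of_nonneg Finset.subset_union_left fun a _ _ => hu a

/-- The sum of a finitely supported family of continuous functions on a compact space is
bounded above. -/
theorem bddAbove_range_finsum {α Y : Type*} [TopologicalSpace Y] [CompactSpace Y]
    {u : α → Y → ℝ} (hu : ∀ a, Continuous (u a)) (hfin : {a | u a ≠ 0}.Finite) :
    BddAbove (Set.range fun y => ∑ᶠ a, u a y) := by
  have hcont : Continuous fun y => ∑ᶠ a, u a y :=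
    continuous_finsum hu fun y => ⟨Set.univ, Filter.univ_mem, hfin.subset fun a ha h0 => by
      obtain ⟨z, hz, -⟩ := ha
      exact hz (by rw [h0]; rfl)⟩
  exact (isCompact_range hcont).bddAbove

/-- The Schur test for nonnegative kernels on finite sets. -/
theorem schur_test {α β : Type*} (G : Finset α) (S : Finset β) {a : α → β → ℝ} {b : β → ℝ}
    {C : ℝ} (ha : ∀ g h, 0 ≤ a g h) (hC : 0 ≤ C)
    (hrow : ∀ g, ∑ h ∈ S, a g h ≤ C) (hcol : ∀ h, ∑ g ∈ G, a g h ≤ C) :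
    ∑ g ∈ G, (∑ h ∈ S, a g h * b h) ^ 2 ≤ C ^ 2 * ∑ h ∈ S, b h ^ 2 := by
  have hnn : ∀ g h, 0 ≤ a g h * b h ^ 2 := fun g h => mul_nonneg (ha g h) (sq_nonneg _)
  calc ∑ g ∈ G, (∑ h ∈ S, a g h * b h) ^ 2
      ≤ ∑ g ∈ G, C * ∑ h ∈ S, a g h * b h ^ 2 := by
        refine Finset.sum_le_sum fun g _ => ?_
        refine (Finset.sum_sq_le_sum_mul_sum_of_sq_le_mul S (fun h _ => ha g h)
          (fun h _ => hnn g h) fun h _ => le_of_eq (by ring)).trans ?_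
        exact mul_le_mul_of_nonneg_right (hrow g) (Finset.sum_nonneg fun h _ => hnn g h)
    _ = C * ∑ h ∈ S, (∑ g ∈ G, a g h) * b h ^ 2 := by
        rw [← Finset.mul_sum, Finset.sum_comm]
        simp only [Finset.sum_mul]
    _ ≤ C * ∑ h ∈ S, C * b h ^ 2 := by
        gcongr with h _
        exact hcol h
    _ = C ^ 2 * ∑ h ∈ S, b h ^ 2 := by
        rw [← Finset.mul_sum]; ring

theorem mulLen_iterate_apply {G Y : Type*} (ℓ : G → Y → ℝ) (f : G → Y → ℂ) (k : ℕ) (g : G)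
    (x : Y) : (mulLen ℓ)^[k] f g x = (ℓ g x : ℂ) ^ k * f g x := by
  induction k with
  | zero => simp
  | succ k ih =>
    rw [Function.iterate_succ_apply', mulLen, ih]
    ring

theorem IsCc.mulLen {G Y : Type*} [TopologicalSpace Y] {ℓ : G → Y → ℝ}
    (hℓ : ∀ g, Continuous (ℓ g)) {f : G → Y → ℂ} (hf : IsCc f) : IsCc (mulLen ℓ f) := by
  refine ⟨fun g => (Complex.continuous_ofReal.comp (hℓ g)).mul (hf.1 g),
    hf.2.subset fun g hg h0 => hg ?_⟩
  ext x
  simp [_root_.mulLen, h0]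

theorem IsCc.mulLen_iterate {G Y : Type*} [TopologicalSpace Y] {ℓ : G → Y → ℝ}
    (hℓ : ∀ g, Continuous (ℓ g)) {f : G → Y → ℂ} (hf : IsCc f) (k : ℕ) :
    IsCc ((_root_.mulLen ℓ)^[k] f) := by
  induction k with
  | zero => exact hf
  | succ k ih =>
    rw [Function.iterate_succ_apply']
    exact ih.mulLen hℓ

/-- The kernel of `Δ^k(f)` is `(ℓ(g, x) - ℓ(h, x))^k f(g h⁻¹, h ⋅ x)`. -/
theorem deltaIter_apply {G Y : Type*} [Group G] [MulAction G Y] (ℓ : G → Y → ℝ)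
    (f : G → Y → ℂ) (S : Finset G) (k : ℕ) (ξ : G → Y → ℂ) (hS : ∀ h ∉ S, ξ h = 0)
    (g : G) (x : Y) :
    deltaIter ℓ f k ξ g x =
      ∑ h ∈ S, ((ℓ g x : ℂ) - ℓ h x) ^ k * (f (g * h⁻¹) (h • x) * ξ h x) := by
  induction k generalizing ξ with
  | zero =>
    simp only [deltaIter, convCc, pow_zero, one_mul]
    refine finsum_eq_sum_of_support_subset _ fun h hh => ?_
    by_contra hns
    exact hh (by simp [hS h hns])
  | succ k ih =>
    have hS' : ∀ h ∉ S, mulLen ℓ ξ h = 0 := fun h hh => by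
      ext y
      simp [mulLen, hS h hh]
    simp only [deltaIter, Pi.sub_apply]
    rw [ih _ hS', mulLen, ih _ hS, Finset.mul_sum, ← Finset.sum_sub_distrib]
    refine Finset.sum_congr rfl fun h _ => ?_
    rw [mulLen]
    ring

theorem IsLength.abs_sub_le {ℓ : Γ → X → ℝ} (hℓ : IsLength ℓ) (g h : Γ) (x : X) :
    |ℓ g x - ℓ h x| ≤ ℓ (g * h⁻¹) (h • x) := by
  obtain ⟨-, -, -, hinv, htri⟩ := hℓ
  have h1 := htri (g * h⁻¹) h x
  have h2 := htri (g * h⁻¹)⁻¹ g x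
  have h3 := hinv (g * h⁻¹) (h • x)
  simp only [smul_smul, mul_inv_rev, inv_inv, mul_assoc,
    inv_mul_cancel, mul_one] at h1 h2 h3
  rw [abs_le]
  constructor <;> linarith

theorem normI_nonneg {G Y : Type*} [Group G] [MulAction G Y] (F : G → Y → ℂ) : 0 ≤ normI F :=
  le_max_of_le_left <| Real.iSup_nonneg fun _ => finsum_nonneg fun _ => norm_nonneg _

theorem hnorm_nonneg {G Y : Type*} (ξ : G → Y → ℂ) : 0 ≤ hnorm ξ :=
  Real.iSup_nonneg fun _ => Real.sqrt_nonneg _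

theorem IsCc.sum_norm_le_normI [CompactSpace X] {F : Γ → X → ℂ} (hF : IsCc F) (G : Finset Γ)
    (x : X) : ∑ g ∈ G, ‖F g x‖ ≤ normI F := by
  have hfin : {g | (fun x => ‖F g x‖) ≠ 0}.Finite := hF.2.subset fun g hg h0 => hg (by
    ext x
    simp [h0])
  refine (sum_le_finsum_of_nonneg (fun g => norm_nonneg (F g x))
    (hF.2.subset fun g hg h0 => hg (by simp [h0])) G).trans ?_
  exact (le_ciSup (bddAbove_range_finsum (fun g => (hF.1 g).norm) hfin) x).trans (le_max_left _ _)

theorem IsCc.sum_norm_inv_le_normI [CompactSpace X] [ContinuousConstSMul Γ X] {F : Γ → X → ℂ}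
    (hF : IsCc F) (G : Finset Γ) (x : X) : ∑ g ∈ G, ‖F g⁻¹ (g • x)‖ ≤ normI F := by
  have hinv : {g | F g⁻¹ ≠ 0}.Finite := hF.2.preimage inv_injective.injOn
  have hfin : {g | (fun x => ‖F g⁻¹ (g • x)‖) ≠ 0}.Finite := hinv.subset fun g hg h0 => hg (by
    ext x
    simp [h0])
  refine (sum_le_finsum_of_nonneg (fun g => norm_nonneg (F g⁻¹ (g • x)))
    (hinv.subset fun g hg h0 => hg (by simp [h0])) G).trans ?_
  exact (le_ciSup (bddAbove_range_finsum
    (fun g => ((hF.1 g⁻¹).comp (continuous_const_smul g)).norm) hfin) x).trans (le_max_right _ _)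

theorem IsCc.sqrt_sum_le_hnorm {G Y : Type*} [TopologicalSpace Y] [CompactSpace Y]
    {ξ : G → Y → ℂ} (hξ : IsCc ξ) (S : Finset G) (x : Y) : √(∑ h ∈ S, ‖ξ h x‖ ^ 2) ≤ hnorm ξ := by
  have hfin : {g | (fun x => ‖ξ g x‖ ^ 2) ≠ 0}.Finite := hξ.2.subset fun g hg h0 => hg (by
    ext x
    simp [h0])
  obtain ⟨B, hB⟩ := bddAbove_range_finsum (fun g => (hξ.1 g).norm.pow 2) hfin
  refine (Real.sqrt_le_sqrt (sum_le_finsum_of_nonneg (fun h => sq_nonneg ‖ξ h x‖)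
    (hξ.2.subset fun g hg h0 => hg (by simp [h0])) S)).trans ?_
  refine le_ciSup (f := fun x => √(∑ᶠ g, ‖ξ g x‖ ^ 2)) ⟨√B, ?_⟩ x
  rintro _ ⟨y, rfl⟩
  exact Real.sqrt_le_sqrt (hB ⟨y, rfl⟩)

/-- An operator on `C_c` dominated pointwise by convolution with `‖F‖` is bounded by `‖F‖_I`. -/
theorem hnorm_le_normI_mul_hnorm [CompactSpace X] [ContinuousConstSMul Γ X]
    {F ξ η : Γ → X → ℂ} (hF : IsCc F) (hξ : IsCc ξ) (S : Finset Γ)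
    (hη : ∀ g x, ‖η g x‖ ≤ ∑ h ∈ S, ‖F (g * h⁻¹) (h • x)‖ * ‖ξ h x‖) :
    hnorm η ≤ normI F * hnorm ξ := by
  classical
  refine Real.iSup_le (fun x => ?_) (mul_nonneg (normI_nonneg F) (hnorm_nonneg ξ))
  refine le_trans ?_ (mul_le_mul_of_nonneg_left (hξ.sqrt_sum_le_hnorm S x) (normI_nonneg F))
  rw [← Real.sqrt_sq (normI_nonneg F), ← Real.sqrt_mul (sq_nonneg _)]
  refine Real.sqrt_le_sqrt (finsum_le_of_forall_sum_le fun G => ?_)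
  refine (Finset.sum_le_sum fun g _ => pow_le_pow_left₀ (norm_nonneg _) (hη g x) 2).trans ?_
  refine schur_test G S (fun _ _ => norm_nonneg _) (normI_nonneg F) (fun g => ?_) fun h => ?_
  · have key := hF.sum_norm_inv_le_normI (S.map (Equiv.mulRight g⁻¹).toEmbedding) (g • x)
    simpa [smul_smul] using key
  · have key := hF.sum_norm_le_normI (G.map (Equiv.mulRight h⁻¹).toEmbedding) (h • x)
    simpa using key

/-- `‖Δ^k(f)(ξ)‖ ≤ ‖M_ℓ^k(f)‖_I ‖ξ‖`. -/
theorem stmt_1 [CompactSpace X] [T2Space X] [ContinuousConstSMul Γ X]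
    (ℓ : Γ → X → ℝ) (hℓ : IsLength ℓ)
    (f ξ : Γ → X → ℂ) (hf : IsCc f) (hξ : IsCc ξ)
    (k : ℕ) (hk : 1 ≤ k) :
    hnorm (deltaIter ℓ f k ξ) ≤ normI ((mulLen ℓ)^[k] f) * hnorm ξ := by
  refine hnorm_le_normI_mul_hnorm (hf.mulLen_iterate hℓ.1 k) hξ hξ.2.toFinset fun g x => ?_
  rw [deltaIter_apply ℓ f hξ.2.toFinset k ξ (fun h hh => by simpa using hh)]
  refine (norm_sum_le _ _).trans (Finset.sum_le_sum fun h _ => ?_)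
  rw [mulLen_iterate_apply, norm_mul, norm_mul, norm_mul, norm_pow, norm_pow, ← mul_assoc,
    ← Complex.ofReal_sub, Complex.norm_real, Complex.norm_real]
  gcongr
  exact (hℓ.abs_sub_le g h x).trans (le_abs_self _)
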